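/- arXiv:math/0510609 — 2 statements merged into one kernel-verified Lean document; each statement's English description precedes it below -/
import Mathlib

section
/- Let n ∈ ℕ. Suppose that for every infinite subset M of ℕ we are given a successive sequence F₁^M < ⋯ < Fₙ^M of non-empty finite subsets of M, and that for each j the map M ↦ F_j^M from infinite subsets of ℕ (with the product topology on 2^ℕ) to finite subsets of ℕ (discrete) is continuous. Then for every infinite subset N of ℕ there exist infinite subsets L, M of N such that (i) for each j = 1,…,n either F_j^L is an initial segment of F_j^M or F_j^M is an initial segment of F_j^L, and (ii) L ∩ M = ⋃_{j=1}^n (F_j^L ∩ F_j^M). -/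
/-- `A` is an initial segment of `B`. -/
def IsInitSeg (A B : Finset ℕ) : Prop :=
  A ⊆ B ∧ ∀ b ∈ B, ∀ a ∈ A, b ≤ a → b ∈ A

/-- Infinite subsets. -/
abbrev InfSetN := {M : Set ℕ // M.Infinite}

/-- `L` extends `u` with elements of `Y` above `u`. -/
def ExtN (u : Finset ℕ) (Y L : Set ℕ) : Prop :=
  ↑u ⊆ L ∧ ∀ x ∈ L, x ∈ u ∨ (x ∈ Y ∧ ∀ y ∈ u, y < x)

theorem tail_infinite (u : Finset ℕ) (Y : Set ℕ) (hY : Y.Infinite) :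
    {x | x ∈ Y ∧ ∀ y ∈ u, y < x}.Infinite := by
  have h : (Y \ Set.Iic (u.sup id)).Infinite := hY.sdiff (Set.finite_Iic _)
  refine h.mono ?_
  rintro x ⟨hx, hx'⟩
  refine ⟨hx, fun y hy => ?_⟩
  have : y ≤ u.sup id := Finset.le_sup (f := id) hy
  simp only [Set.mem_Iic, not_le] at hx'
  omega

theorem fusion (P : Finset ℕ → Set ℕ → Prop)
    (hmono : ∀ u X Y, (∀ y ∈ Y, (∀ x ∈ u, x < y) → y ∈ X) → P u X → P u Y)
    (hdense : ∀ u X, X.Infinite → ∃ Y ⊆ X, Y.Infinite ∧ P u Y)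
    (X : Set ℕ) (hX : X.Infinite) :
    ∃ Y ⊆ X, Y.Infinite ∧ ∀ u : Finset ℕ, ↑u ⊆ Y → P u Y := by
  classical
  have many : ∀ (S : Finset (Finset ℕ)) (X : Set ℕ), X.Infinite →
      ∃ Y ⊆ X, Y.Infinite ∧ ∀ u ∈ S, P u Y := by
    intro S
    induction S using Finset.induction_on with
    | empty => intro X hX; exact ⟨X, subset_rfl, hX, by simp⟩
    | insert u S _ ih =>
      intro X hX
      obtain ⟨Y, hYX, hY, h1⟩ := ih X hX
      obtain ⟨Z, hZY, hZ, h2⟩ := hdense u Y hY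
      refine ⟨Z, hZY.trans hYX, hZ, fun w hw => ?_⟩
      rcases Finset.mem_insert.1 hw with rfl | hw
      · exact h2
      · exact hmono w Y Z (fun y hy _ => hZY hy) (h1 w hw)
  have step : ∀ X : InfSetN, ∃ Y : InfSetN, Y.1 ⊆ X.1 ∧ (∀ y ∈ Y.1, sInf X.1 < y) ∧
      ∀ u ∈ (Finset.range (sInf X.1 + 1)).powerset, P u Y.1 := by
    intro X
    obtain ⟨Y, hYX, hY, h⟩ := many (Finset.range (sInf X.1 + 1)).powerset _
      (tail_infinite {sInf X.1} X.1 X.2)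
    exact ⟨⟨Y, hY⟩, fun y hy => (hYX hy).1, fun y hy => (hYX hy).2 _ (by simp), h⟩
  choose f hf1 hf2 hf3 using step
  obtain ⟨X0, hX0, hX0i, hP0⟩ := hdense ∅ X hX
  let S : ℕ → InfSetN := fun i => f^[i] ⟨X0, hX0i⟩
  have hS : ∀ i, S (i+1) = f (S i) := fun i => Function.iterate_succ_apply' _ _ _
  have hanti : Antitone fun i => (S i).1 := antitone_nat_of_succ_le fun i => by
    rw [hS]; exact hf1 _
  let k : ℕ → ℕ := fun i => sInf (S i).1
  have hk : ∀ i, k i ∈ (S i).1 := fun i => Nat.sInf_mem (S i).2.nonempty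
  have hkm : StrictMono k := strictMono_nat_of_lt_succ fun i => by
    refine hf2 _ _ ?_
    rw [← hS]; exact hk _
  refine ⟨Set.range k, ?_, Set.infinite_range_of_injective hkm.injective, ?_⟩
  · rintro _ ⟨i, rfl⟩
    exact hX0 (hanti (Nat.zero_le i) (hk i))
  · intro u hu
    rcases u.eq_empty_or_nonempty with rfl | hne
    · refine hmono ∅ X0 _ ?_ hP0
      rintro _ ⟨i, rfl⟩ -
      exact hanti (Nat.zero_le i) (hk i)
    · obtain ⟨i, hi⟩ := hu (Finset.max'_mem u hne)
      have : P u (S (i+1)).1 := by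
        rw [hS]
        refine hf3 _ _ ?_
        rw [Finset.mem_powerset]
        intro x hx
        have := Finset.le_max' u x hx
        rw [Finset.mem_range]
        change x < k i + 1
        omega
      refine hmono u _ _ ?_ this
      rintro _ ⟨m, rfl⟩ hm
      have h1 : k i < k m := by rw [hi]; exact hm _ (Finset.max'_mem u hne)
      exact hanti (hkm.lt_iff_lt.1 h1) (hk m)

theorem ramsey {C : Type} [Finite C] (c : InfSetN → C)
    (hc : ∀ M : InfSetN, ∃ r : ℕ, ∀ L : InfSetN, (∀ i ≤ r, (i ∈ L.1 ↔ i ∈ M.1)) → c L = c M)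
    (X : Set ℕ) (hX : X.Infinite) :
    ∃ Y ⊆ X, Y.Infinite ∧ ∃ a, ∀ L : InfSetN, L.1 ⊆ Y → c L = a := by
  classical
  let D : Finset ℕ → Set ℕ → Prop := fun u Y => ∃ a, ∀ L : InfSetN, ExtN u Y L.1 → c L = a
  have Dmono : ∀ u X Y, (∀ y ∈ Y, (∀ x ∈ u, x < y) → y ∈ X) → D u X → D u Y := by
    rintro u X Y h ⟨a, ha⟩
    refine ⟨a, fun L hL => ha L ⟨hL.1, fun x hx => ?_⟩⟩
    rcases hL.2 x hx with h1 | h1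
    · exact Or.inl h1
    · exact Or.inr ⟨h x h1.1 h1.2, h1.2⟩
  obtain ⟨Y, hYX, hY, hP⟩ := fusion
    (fun u Y => D u Y ∨ ∀ Z : Set ℕ, Z.Infinite → (∀ z ∈ Z, (∀ x ∈ u, x < z) → z ∈ Y) → ¬ D u Z)
    (by
      rintro u X Y h (h1 | h1)
      · exact Or.inl (Dmono u X Y h h1)
      · exact Or.inr fun Z hZ hZY => h1 Z hZ fun z hz hz' => h z (hZY z hz hz') hz')
    (by
      intro u X hX
      by_cases h : ∃ Z : Set ℕ, Z.Infinite ∧ (∀ z ∈ Z, (∀ x ∈ u, x < z) → z ∈ X) ∧ D u Z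
      · obtain ⟨Z, hZ, hZX, hD⟩ := h
        exact ⟨_, fun z hz => hZX z hz.1 hz.2, tail_infinite u Z hZ,
          Or.inl (Dmono u Z _ (fun y hy _ => hy.1) hD)⟩
      · push Not at h
        exact ⟨X, subset_rfl, hX, Or.inr h⟩) X hX
  by_cases h0 : D ∅ Y
  · obtain ⟨a, ha⟩ := h0
    exact ⟨Y, hYX, hY, a, fun L hL => ha L ⟨by simp, fun x hx => Or.inr ⟨hL hx, by simp⟩⟩⟩
  exfalso
  have step : ∀ u : {u : Finset ℕ // ↑u ⊆ Y ∧ ¬ D u Y}, ∃ k ∈ Y, (∀ x ∈ u.1, x < k) ∧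
      ¬ D (insert k u.1) Y := by
    rintro ⟨u, hu, hD⟩
    by_contra! hcon
    have hund := (hP u hu).resolve_left hD
    have : Nonempty C := ⟨c ⟨Y, hY⟩⟩
    choose! a ha using hcon
    have hT := tail_infinite u Y hY
    have : ∃ b, {k | (k ∈ Y ∧ ∀ y ∈ u, y < k) ∧ a k = b}.Infinite := by
      by_contra! hfin
      refine hT ((Set.finite_iUnion (fun b => hfin b)).subset ?_)
      intro k hk
      exact Set.mem_iUnion.2 ⟨a k, hk, rfl⟩
    obtain ⟨b, hb⟩ := this
    refine hund _ hb (fun z hz _ => hz.1.1) ⟨b, fun L hL => ?_⟩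
    have hLt := (tail_infinite u L.1 L.2).nonempty
    set k := sInf {x | x ∈ L.1 ∧ ∀ y ∈ u, y < x} with hkdef
    have hk : k ∈ L.1 ∧ ∀ y ∈ u, y < k := Nat.sInf_mem hLt
    have hkK : (k ∈ Y ∧ ∀ y ∈ u, y < k) ∧ a k = b := by
      rcases hL.2 k hk.1 with h | h
      · exact absurd (hk.2 k h) (lt_irrefl _)
      · exact h.1
    rw [← hkK.2]
    refine ha k hkK.1.1 hkK.1.2 L ⟨?_, fun x hx => ?_⟩
    · intro x hx
      rcases Finset.mem_insert.1 (Finset.mem_coe.1 hx) with rfl | hx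
      · exact hk.1
      · exact hL.1 hx
    · rcases hL.2 x hx with h | h
      · exact Or.inl (Finset.mem_insert_of_mem h)
      · have hle : k ≤ x := Nat.sInf_le ⟨hx, h.2⟩
        rcases hle.eq_or_lt with he | hlt
        · exact Or.inl (by rw [← he]; exact Finset.mem_insert_self _ _)
        · refine Or.inr ⟨h.1.1.1, fun y hy => ?_⟩
          rcases Finset.mem_insert.1 hy with rfl | hy
          · exact hlt
          · exact h.2 y hy
  choose g hgY hglt hgD using step
  let f : {u : Finset ℕ // ↑u ⊆ Y ∧ ¬ D u Y} → {u : Finset ℕ // ↑u ⊆ Y ∧ ¬ D u Y} := fun u =>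
    ⟨insert (g u) u.1, by
      intro x hx
      rcases Finset.mem_insert.1 (Finset.mem_coe.1 hx) with rfl | hx
      · exact hgY u
      · exact u.2.1 hx, hgD u⟩
  let U : ℕ → {u : Finset ℕ // ↑u ⊆ Y ∧ ¬ D u Y} := fun i => f^[i] ⟨∅, by simp, h0⟩
  have hU : ∀ i, (U (i+1)).1 = insert (g (U i)) (U i).1 := fun i => by
    change (f^[i+1] _).1 = _
    rw [Function.iterate_succ_apply']
  have hUm : Monotone fun i => (U i).1 := monotone_nat_of_le_succ fun i => by
    rw [hU]; exact Finset.subset_insert _ _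
  have hgmem : ∀ i, g (U i) ∈ (U (i+1)).1 := fun i => by
    rw [hU]; exact Finset.mem_insert_self _ _
  have hgm : StrictMono fun i => g (U i) := strictMono_nat_of_lt_succ fun i =>
    hglt _ _ (hgmem i)
  have hUr : ∀ i, ∀ x ∈ (U i).1, ∃ m < i, g (U m) = x := by
    intro i
    induction i with
    | zero => intro x hx; exact absurd hx (by simp [U])
    | succ i ih =>
      intro x hx
      rw [hU] at hx
      rcases Finset.mem_insert.1 hx with rfl | hx
      · exact ⟨i, by omega, rfl⟩
      · obtain ⟨m, hm, h⟩ := ih x hx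
        exact ⟨m, by omega, h⟩
  let M : InfSetN := ⟨Set.range fun i => g (U i), Set.infinite_range_of_injective hgm.injective⟩
  obtain ⟨r, hr⟩ := hc M
  refine (U (r+1)).2.2 ⟨c M, fun L hL => hr L fun i hi => ⟨fun h => ?_, ?_⟩⟩
  · rcases hL.2 i h with h | h
    · obtain ⟨m, -, hm⟩ := hUr _ _ h
      exact ⟨m, hm⟩
    · have h1 := h.2 _ (hgmem r)
      have h2 : r ≤ g (U r) := hgm.id_le r
      omega
  · rintro ⟨m, rfl⟩
    have h2 : m ≤ g (U m) := hgm.id_le m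
    simp only at hi
    exact hL.1 (hUm (show m + 1 ≤ r + 1 by omega) (hgmem m))

open Classical in
/-- The color of `x` with respect to a sequence of sets. -/
noncomputable def colr {n : ℕ} (G : Fin n → Finset ℕ) (x : ℕ) : ℕ :=
  if h : ∃ j, x ∈ G j then (h.choose : ℕ) + 1
  else if ∀ j, ∀ y ∈ G j, y < x then n + 1 else 0

theorem colr_le {n : ℕ} (G : Fin n → Finset ℕ) (x : ℕ) : colr G x < n + 2 := by
  unfold colr
  split_ifs with h
  · have := h.choose.2
    omega
  · omega
  · omega

theorem colr_iff {n : ℕ} (G : Fin n → Finset ℕ)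
    (hs : ∀ j j' : Fin n, j < j' → ∀ a ∈ G j, ∀ b ∈ G j', a < b) (x : ℕ) (j : Fin n) :
    colr G x = j + 1 ↔ x ∈ G j := by
  unfold colr
  have hj := j.2
  split_ifs with h h'
  · have hx := h.choose_spec
    constructor
    · intro he
      have : h.choose = j := Fin.ext (by omega)
      rwa [this] at hx
    · intro hxj
      rcases lt_trichotomy h.choose j with hl | he | hl
      · exact absurd (hs _ _ hl _ hx _ hxj) (lt_irrefl _)
      · rw [he]
      · exact absurd (hs _ _ hl _ hxj _ hx) (lt_irrefl _)
  · constructor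
    · intro hh; first | exact hh.elim | omega
    · intro hx; exact absurd ⟨j, hx⟩ h
  · constructor
    · intro hh; first | exact hh.elim | omega
    · intro hx; exact absurd ⟨j, hx⟩ h

theorem colr_gt {n : ℕ} (G : Fin n → Finset ℕ)
    (hs : ∀ j j' : Fin n, j < j' → ∀ a ∈ G j, ∀ b ∈ G j', a < b) (x : ℕ) (j : Fin n)
    (h : (j : ℕ) + 1 < colr G x) : ∀ y ∈ G j, y < x := by
  unfold colr at h
  split_ifs at h with h1 h2
  · intro y hy
    exact hs j h1.choose (Fin.lt_def.2 (by omega)) y hy x h1.choose_spec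
  · exact h2 j
  · omega

theorem colr_top {n : ℕ} (G : Fin n → Finset ℕ) (x : ℕ) (h : ∀ j, ∀ y ∈ G j, y < x) :
    colr G x = n + 1 := by
  unfold colr
  rw [dif_neg, if_pos h]
  rintro ⟨j, hj⟩
  exact lt_irrefl _ (h j x hj)

/-- First element of `L` above `u`. -/
noncomputable def fst (u : Finset ℕ) (L : Set ℕ) : ℕ := sInf {x | x ∈ L ∧ ∀ y ∈ u, y < x}

theorem fst_mem (u : Finset ℕ) (L : Set ℕ) (hL : L.Infinite) :
    fst u L ∈ L ∧ ∀ y ∈ u, y < fst u L := Nat.sInf_mem (tail_infinite u L hL).nonempty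

theorem fst_le (u : Finset ℕ) (L : Set ℕ) (x : ℕ) (hx : x ∈ L) (h : ∀ y ∈ u, y < x) :
    fst u L ≤ x := Nat.sInf_le ⟨hx, h⟩

theorem stabilize (n : ℕ) (F : Fin n → InfSetN → Finset ℕ)
    (hcont : ∀ j M, ∃ r : ℕ, ∀ L : InfSetN,
      (∀ i ≤ r, (i ∈ L.1 ↔ i ∈ M.1)) → F j L = F j M) (N : Set ℕ) (hN : N.Infinite) :
    ∃ Y ⊆ N, Y.Infinite ∧ ∀ u : Finset ℕ, ↑u ⊆ Y → ∃ a : ℕ, ∀ L : InfSetN, ExtN u Y L.1 →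
      colr (fun j => F j L) (fst u L.1) = a := by
  apply fusion (fun u Y => ∃ a : ℕ, ∀ L : InfSetN, ExtN u Y L.1 →
      colr (fun j => F j L) (fst u L.1) = a) _ _ N hN
  · rintro u X Y h ⟨a, ha⟩
    refine ⟨a, fun L hL => ha L ⟨hL.1, fun x hx => ?_⟩⟩
    rcases hL.2 x hx with h1 | h1
    · exact Or.inl h1
    · exact Or.inr ⟨h x h1.1 h1.2, h1.2⟩
  · intro u X hX
    let e : InfSetN → InfSetN := fun L => ⟨{x | x ∈ u ∨ (x ∈ L.1 ∧ ∀ y ∈ u, y < x)},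
      (tail_infinite u L.1 L.2).mono fun x hx => Or.inr hx⟩
    let c : InfSetN → Fin (n+2) := fun L =>
      ⟨colr (fun j => F j (e L)) (fst u (e L).1), colr_le _ _⟩
    obtain ⟨Y, hYX, hY, a, ha⟩ := ramsey c (by
      intro M
      choose r hr using fun j => hcont j (e M)
      refine ⟨Finset.univ.sup r + fst u (e M).1, fun L hL => ?_⟩
      have hag : ∀ i ≤ Finset.univ.sup r + fst u (e M).1, (i ∈ (e L).1 ↔ i ∈ (e M).1) := by
        intro i hi
        simp only [e, Set.mem_ofPred_eq, hL i hi]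
      have h1 : (fun j => F j (e L)) = fun j => F j (e M) := by
        funext j
        refine hr j _ fun i hi => hag i ?_
        have : r j ≤ Finset.univ.sup r := Finset.le_sup (Finset.mem_univ j)
        omega
      have h2 : fst u (e L).1 = fst u (e M).1 := by
        have hM := fst_mem u _ (e M).2
        have hL' := fst_mem u _ (e L).2
        have hle : fst u (e L).1 ≤ fst u (e M).1 :=
          fst_le _ _ _ ((hag _ (by omega)).2 hM.1) hM.2
        exact le_antisymm hle (fst_le _ _ _ ((hag _ (by omega)).1 hL'.1) hL'.2)
      simp only [c, h1, h2]) X hX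
    refine ⟨Y, hYX, hY, a, fun L hL => ?_⟩
    let L' : InfSetN := ⟨_, tail_infinite u L.1 L.2⟩
    have hLL : e L' = L := by
      apply Subtype.ext
      ext x
      constructor
      · rintro (h | h)
        · exact hL.1 h
        · exact h.1.1
      · intro hx
        rcases hL.2 x hx with h | h
        · exact Or.inl h
        · exact Or.inr ⟨⟨hx, h.2⟩, h.2⟩
    have := ha L' (by
      rintro x ⟨hx, hxu⟩
      rcases hL.2 x hx with h | h
      · exact absurd (hxu x h) (lt_irrefl _)
      · exact h.1)
    rw [← this]
    simp only [c, hLL]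

theorem init_of_key (A B : Finset ℕ) (h1 : ∀ x ∈ A, x ∉ B → ∀ y ∈ B, y < x)
    (h2 : ∀ x ∈ B, x ∉ A → ∀ y ∈ A, y < x) : IsInitSeg A B ∨ IsInitSeg B A := by
  by_cases h : A ⊆ B
  · refine Or.inl ⟨h, fun b hb a ha hba => ?_⟩
    by_contra hbA
    exact absurd (h2 b hb hbA a ha) (by omega)
  · obtain ⟨x, hxA, hxB⟩ := Finset.not_subset.1 h
    refine Or.inr ⟨fun y hy => ?_, fun b hb a ha hba => ?_⟩
    · by_contra hyA
      have := h1 x hxA hxB y hy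
      have := h2 y hy hyA x hxA
      omega
    · by_contra hbB
      exact absurd (h1 b hb hbB a ha) (by omega)

/-- The Matching Lemma.  Infinite subsets of ℕ carry the product topology from `2^ℕ`;
continuity of each `F j` into the discrete space of finite sets is expressed as local
constancy: the value is determined by an initial segment of the argument. -/
theorem matching_lemma (n : ℕ)
    (F : Fin n → {M : Set ℕ // M.Infinite} → Finset ℕ)
    (hsub : ∀ M j, (↑(F j M) : Set ℕ) ⊆ M.1)
    (hne : ∀ M j, (F j M).Nonempty)
    (hsucc : ∀ M, ∀ j j' : Fin n, j < j' → ∀ a ∈ F j M, ∀ b ∈ F j' M, a < b)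
    (hcont : ∀ j M, ∃ r : ℕ, ∀ L : {M : Set ℕ // M.Infinite},
      (∀ i ≤ r, (i ∈ L.1 ↔ i ∈ M.1)) → F j L = F j M) :
    ∀ N : Set ℕ, N.Infinite →
      ∃ L M : {M : Set ℕ // M.Infinite}, L.1 ⊆ N ∧ M.1 ⊆ N ∧
        (∀ j : Fin n, IsInitSeg (F j L) (F j M) ∨ IsInitSeg (F j M) (F j L)) ∧
        L.1 ∩ M.1 = ⋃ j : Fin n, (↑(F j L) ∩ ↑(F j M) : Set ℕ) := by
  classical
  intro N hN
  obtain ⟨Y, hYN, hY, hψ⟩ := stabilize n F hcont N hN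
  choose! ψ hψ using hψ
  let e : ℕ → ℕ := Nat.nth (· ∈ Y)
  have he : StrictMono e := Nat.nth_strictMono hY
  have heY : ∀ i, e i ∈ Y := fun i => Nat.nth_mem_of_infinite hY i
  -- the two approximations
  let st : ℕ → Finset ℕ × Finset ℕ := fun i => Nat.rec (∅, ∅) (fun i p =>
    (if ψ p.1 ≤ ψ p.2 then insert (e (2*i)) p.1 else p.1,
     if ψ p.2 ≤ ψ p.1 then
      insert (if ψ p.1 = ψ p.2 ∧ 1 ≤ ψ p.1 ∧ ψ p.1 ≤ n then e (2*i) else e (2*i+1)) p.2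
     else p.2)) i
  let u : ℕ → Finset ℕ := fun i => (st i).1
  let v : ℕ → Finset ℕ := fun i => (st i).2
  let q : ℕ → ℕ := fun i =>
    if ψ (u i) = ψ (v i) ∧ 1 ≤ ψ (u i) ∧ ψ (u i) ≤ n then e (2*i) else e (2*i+1)
  have hu0 : u 0 = ∅ := rfl
  have hv0 : v 0 = ∅ := rfl
  have hu : ∀ i, u (i+1) = if ψ (u i) ≤ ψ (v i) then insert (e (2*i)) (u i) else u i :=
    fun i => rfl
  have hv : ∀ i, v (i+1) = if ψ (v i) ≤ ψ (u i) then insert (q i) (v i) else v i :=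
    fun i => rfl
  clear_value u v
  have hq : ∀ i, q i = e (2*i) ∨ q i = e (2*i+1) := by
    intro i; simp only [q]; split_ifs <;> simp
  -- general facts about a one-sided run
  have gen : ∀ (w : ℕ → Finset ℕ) (A : ℕ → Prop) [DecidablePred A] (p : ℕ → ℕ), w 0 = ∅ →
      (∀ i, w (i+1) = if A i then insert (p i) (w i) else w i) →
      (∀ i, p i = e (2*i) ∨ p i = e (2*i+1)) →
      ∃ L : Set ℕ, L ⊆ Y ∧ (∀ i, ExtN (w i) Y L) ∧ (∀ x, x ∈ L ↔ ∃ i, A i ∧ x = p i) ∧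
        (∀ i, ∀ x ∈ w i, x < e (2*i)) ∧ ((∀ m, ∃ i ≥ m, A i) → L.Infinite) := by
    intro w A _ p hw0 hw hp
    have hple : ∀ i m, i < m → p i < e (2*m) := by
      intro i m him
      rcases hp i with h | h <;> rw [h] <;> exact he (by omega)
    have hpge : ∀ i, e (2*i) ≤ p i := by
      intro i
      rcases hp i with h | h <;> rw [h]
      exact (he (by omega)).le
    have hpY : ∀ i, p i ∈ Y := by
      intro i
      rcases hp i with h | h <;> rw [h] <;> exact heY _
    have hmem : ∀ m x, x ∈ w m ↔ ∃ i < m, A i ∧ x = p i := by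
      intro m
      induction m with
      | zero => intro x; simp [hw0]
      | succ m ih =>
        intro x
        rw [hw]
        constructor
        · intro hx
          split_ifs at hx with hA
          · rcases Finset.mem_insert.1 hx with h | h
            · exact ⟨m, by omega, hA, h⟩
            · obtain ⟨i, hi, h⟩ := (ih x).1 h
              exact ⟨i, by omega, h⟩
          · obtain ⟨i, hi, h⟩ := (ih x).1 hx
            exact ⟨i, by omega, h⟩
        · rintro ⟨i, hi, hA, hx⟩
          rcases Nat.lt_succ_iff_lt_or_eq.1 hi with h | h
          · have := (ih x).2 ⟨i, h, hA, hx⟩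
            split_ifs
            · exact Finset.mem_insert_of_mem this
            · exact this
          · subst h
            rw [if_pos hA, hx]
            exact Finset.mem_insert_self _ _
    have hwlt : ∀ i, ∀ x ∈ w i, x < e (2*i) := by
      intro i x hx
      obtain ⟨m, hm, -, rfl⟩ := (hmem i x).1 hx
      exact hple _ _ hm
    refine ⟨{x | ∃ i, A i ∧ x = p i}, ?_, ?_, fun x => Iff.rfl, hwlt, ?_⟩
    · rintro x ⟨i, -, rfl⟩; exact hpY i
    · intro i
      constructor
      · intro x hx
        obtain ⟨m, -, h⟩ := (hmem i x).1 hx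
        exact ⟨m, h⟩
      · rintro x ⟨m, hA, rfl⟩
        by_cases hm : m < i
        · exact Or.inl ((hmem i _).2 ⟨m, hm, hA, rfl⟩)
        · refine Or.inr ⟨hpY m, fun y hy => ?_⟩
          have h1 := hwlt i y hy
          have h2 : e (2*i) ≤ e (2*m) := he.monotone (by omega)
          have h3 := hpge m
          omega
    · intro hinf
      rw [Set.infinite_iff_exists_gt]
      intro m
      obtain ⟨i, hi, hA⟩ := hinf (m+1)
      refine ⟨p i, ⟨i, hA, rfl⟩, ?_⟩
      have h1 := hpge i
      have h2 : 2*i ≤ e (2*i) := he.id_le _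
      omega
  obtain ⟨L, hLY, hLE, hLm, hult, hLi⟩ :=
    gen u (fun i => ψ (u i) ≤ ψ (v i)) (fun i => e (2*i)) hu0 hu (fun i => Or.inl rfl)
  obtain ⟨M, hMY, hME, hMm, hvlt, hMi⟩ :=
    gen v (fun i => ψ (v i) ≤ ψ (u i)) q hv0 hv hq
  have hqge : ∀ i, e (2*i) ≤ q i := by
    intro i
    rcases hq i with h | h <;> rw [h]
    exact (he (by omega)).le
  -- ψ along the runs
  have huY : ∀ i, ↑(u i) ⊆ Y := fun i => (hLE i).1.trans hLY
  have hvY : ∀ i, ↑(v i) ⊆ Y := fun i => (hME i).1.trans hMY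
  have hψle : ∀ w : Finset ℕ, ↑w ⊆ Y → ψ w ≤ n + 1 := by
    intro w hw
    have := hψ w hw ⟨_, (tail_infinite w Y hY).mono (fun x hx => (Or.inr hx : x ∈ {x | x ∈ w ∨ (x ∈ Y ∧ ∀ y ∈ w, y < x)}))⟩
      ⟨fun x hx => Or.inl hx, fun x hx => hx⟩
    rw [← this]
    exact Nat.lt_succ_iff.1 (colr_le _ _)
  -- an infinite run is eventually of top color
  have top : ∀ (w : ℕ → Finset ℕ) (A : ℕ → Prop) [DecidablePred A] (p : ℕ → ℕ) (K : InfSetN),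
      (∀ i, ExtN (w i) Y K.1) → (∀ x, x ∈ K.1 ↔ ∃ i, A i ∧ x = p i) → K.1 ⊆ Y →
      (∀ i, w (i+1) = if A i then insert (p i) (w i) else w i) →
      ∃ m, ∀ i ≥ m, ψ (w i) = n + 1 := by
    intro w A _ p K hE hm hKY hw
    have hwm : Monotone w := monotone_nat_of_le_succ fun i => by
      rw [hw]; split_ifs
      · exact Finset.subset_insert _ _
      · exact le_rfl
    obtain ⟨z, hzK, hz⟩ := (tail_infinite (Finset.univ.biUnion fun j => F j K) K.1 K.2).nonempty
    obtain ⟨m, hA, rfl⟩ := (hm z).1 hzK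
    refine ⟨m+1, fun i hi => ?_⟩
    have hmem : p m ∈ w i := hwm hi (by rw [hw, if_pos hA]; exact Finset.mem_insert_self _ _)
    rw [← hψ (w i) ((hE i).1.trans hKY) K (hE i)]
    refine colr_top _ _ fun j y hy => ?_
    have h1 := hz y (Finset.mem_biUnion.2 ⟨j, Finset.mem_univ _, hy⟩)
    have h2 := (fst_mem (w i) K.1 K.2).2 _ hmem
    omega
  have inf1 : L.Infinite → M.Infinite := by
    intro h
    obtain ⟨m, hm⟩ := top u _ _ ⟨L, h⟩ hLE hLm hLY hu
    refine hMi fun k => ⟨max k m, le_max_left _ _, ?_⟩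
    rw [hm _ (le_max_right _ _)]
    exact hψle _ (hvY _)
  have inf2 : M.Infinite → L.Infinite := by
    intro h
    obtain ⟨m, hm⟩ := top v _ _ ⟨M, h⟩ hME hMm hMY hv
    refine hLi fun k => ⟨max k m, le_max_left _ _, ?_⟩
    rw [hm _ (le_max_right _ _)]
    exact hψle _ (huY _)
  have hLinf : L.Infinite := by
    by_contra hL
    have hM : ¬ M.Infinite := fun h => hL (inf2 h)
    have h1 : ¬ ∀ m, ∃ i ≥ m, ψ (u i) ≤ ψ (v i) := fun h => hL (hLi h)
    push Not at h1
    obtain ⟨m, hm⟩ := h1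
    exact hM (hMi fun k => ⟨max k m, le_max_left _ _, (hm _ (le_max_right _ _)).le⟩)
  have hMinf : M.Infinite := inf1 hLinf
  let L' : InfSetN := ⟨L, hLinf⟩
  let M' : InfSetN := ⟨M, hMinf⟩
  have cL : ∀ i, colr (fun j => F j L') (fst (u i) L) = ψ (u i) := fun i =>
    hψ _ (huY i) L' (hLE i)
  have cM : ∀ i, colr (fun j => F j M') (fst (v i) M) = ψ (v i) := fun i =>
    hψ _ (hvY i) M' (hME i)
  -- the first element added
  have fL : ∀ i, ψ (u i) ≤ ψ (v i) → fst (u i) L = e (2*i) := by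
    intro i hi
    refine le_antisymm (fst_le _ _ _ ((hLm _).2 ⟨i, hi, rfl⟩) (hult i)) ?_
    have h := fst_mem (u i) L hLinf
    by_contra! hlt
    obtain ⟨m, hm, hx⟩ := (hLm _).1 h.1
    have hmi : m < i := by
      rw [hx] at hlt
      have := he.lt_iff_lt.1 hlt
      omega
    have hum : Monotone u := monotone_nat_of_le_succ fun i => by
      rw [hu]; split_ifs
      · exact Finset.subset_insert _ _
      · exact le_rfl
    have : e (2*m) ∈ u i := hum (show m + 1 ≤ i from hmi)
      (by rw [hu, if_pos hm]; exact Finset.mem_insert_self _ _)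
    rw [← hx] at this
    exact lt_irrefl _ (h.2 _ this)
  have fM : ∀ i, ψ (v i) ≤ ψ (u i) → fst (v i) M = q i := by
    intro i hi
    have hle : fst (v i) M ≤ q i :=
      fst_le _ _ _ ((hMm _).2 ⟨i, hi, rfl⟩) fun y hy => (hvlt i y hy).trans_le (hqge i)
    have h := fst_mem (v i) M hMinf
    obtain ⟨m, hm, hx⟩ := (hMm _).1 h.1
    rcases lt_trichotomy m i with hmi | hmi | hmi
    · have hum : Monotone v := monotone_nat_of_le_succ fun i => by
        rw [hv]; split_ifs
        · exact Finset.subset_insert _ _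
        · exact le_rfl
      have : q m ∈ v i := hum (show m + 1 ≤ i from hmi)
        (by rw [hv, if_pos hm]; exact Finset.mem_insert_self _ _)
      rw [← hx] at this
      exact absurd (h.2 _ this) (lt_irrefl _)
    · rw [hx, hmi]
    · have h1 : q i < e (2*m) := by
        rcases hq i with h | h <;> rw [h] <;> exact he (by omega)
      have := hqge m
      omega
  have iL : ∀ x (j : Fin n), x ∈ F j L' → ∃ i, ψ (u i) ≤ ψ (v i) ∧ x = e (2*i) ∧
      ψ (u i) = j + 1 := by
    intro x j hx
    obtain ⟨i, hi, rfl⟩ := (hLm x).1 (hsub L' j hx)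
    refine ⟨i, hi, rfl, ?_⟩
    rw [← cL, fL i hi]
    exact (colr_iff _ (hsucc L') _ j).2 hx
  have iM : ∀ x (j : Fin n), x ∈ F j M' → ∃ i, ψ (v i) ≤ ψ (u i) ∧ x = q i ∧
      ψ (v i) = j + 1 := by
    intro x j hx
    obtain ⟨i, hi, rfl⟩ := (hMm x).1 (hsub M' j hx)
    refine ⟨i, hi, rfl, ?_⟩
    rw [← cM, fM i hi]
    exact (colr_iff _ (hsucc M') _ j).2 hx
  have both : ∀ i (j : Fin n), ψ (u i) = j + 1 → ψ (v i) = j + 1 →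
      q i = e (2*i) ∧ e (2*i) ∈ F j L' ∧ e (2*i) ∈ F j M' := by
    intro i j h1 h2
    have hj := j.2
    have hqi : q i = e (2*i) := by
      simp only [q]
      rw [if_pos ⟨by omega, by omega, by omega⟩]
    refine ⟨hqi, ?_, ?_⟩
    · rw [← fL i (by omega)]
      exact (colr_iff (fun j => F j L') (hsucc L') _ j).1 (by rw [cL, h1])
    · rw [← hqi, ← fM i (by omega)]
      exact (colr_iff (fun j => F j M') (hsucc M') _ j).1 (by rw [cM, h2])
  refine ⟨L', M', hLY.trans hYN, hMY.trans hYN, fun j => init_of_key _ _ ?_ ?_, ?_⟩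
  · intro x hx hxM y hy
    obtain ⟨i, hi, rfl, hc⟩ := iL x j hx
    rcases hi.eq_or_lt with h | h
    · exact absurd (both i j hc (by omega)).2.2 hxM
    · have h1 := colr_gt (fun j => F j M') (hsucc M') (fst (v i) M) j (by rw [cM]; omega) y hy
      rcases (hME i).2 y (hsub M' j hy) with h2 | h2
      · exact hvlt i y h2
      · have := fst_le (v i) M y (hsub M' j hy) h2.2
        omega
  · intro x hx hxL y hy
    obtain ⟨i, hi, rfl, hc⟩ := iM x j hx
    rcases hi.eq_or_lt with h | h
    · have hb := both i j (by omega) hc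
      exact absurd (hb.1 ▸ hb.2.1) hxL
    · have h1 := colr_gt (fun j => F j L') (hsucc L') (fst (u i) L) j (by rw [cL]; omega) y hy
      rcases (hLE i).2 y (hsub L' j hy) with h2 | h2
      · exact (hult i y h2).trans_le (hqge i)
      · have := fst_le (u i) L y (hsub L' j hy) h2.2
        omega
  · ext x
    constructor
    · rintro ⟨hxL, hxM⟩
      obtain ⟨i, hi, rfl⟩ := (hLm x).1 hxL
      obtain ⟨m, hm, hx⟩ := (hMm _).1 hxM
      have hcond : m = i ∧ ψ (u m) = ψ (v m) ∧ 1 ≤ ψ (u m) ∧ ψ (u m) ≤ n := by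
        simp only [q] at hx
        split_ifs at hx with hcnd
        · have := he.injective hx
          exact ⟨by omega, hcnd⟩
        · have := he.injective hx
          omega
      obtain ⟨rfl, h1, h2, h3⟩ := hcond
      have hb := both m ⟨ψ (u m) - 1, by omega⟩ (by simp only; omega) (by simp only; omega)
      exact Set.mem_iUnion.2 ⟨_, hb.2.1, hb.2.2⟩
    · intro hx
      obtain ⟨j, h1, h2⟩ := Set.mem_iUnion.1 hx
      exact ⟨hsub L' j h1, hsub M' j h2⟩
end

section
/- Let k ∈ ℕ and let ℱ ⊆ {0,1,…,k}^ℕ be a compact family (in the product topology) consisting of sequences of finite support. Then there exists an infinite subset M of ℕ such that the family ℱ_M of restrictions to M of elements of ℱ is weakly hereditary. -/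
open Filter Topology in
lemma dm_lim (ℱ : Set (ℕ → ℕ)) (hcomp : IsCompact ℱ) (c : ℕ → ℕ → ℕ) (hc : ∀ n, c n ∈ ℱ) :
    ∃ x ∈ ℱ, ∀ i, ∀ᶠ n in (hyperfilter ℕ : Filter ℕ), c n i = x i := by
  obtain ⟨x, hx, hle⟩ := hcomp.ultrafilter_le_nhds ((hyperfilter ℕ).map c) (by
    rw [le_principal_iff]
    exact Filter.mem_map.2 (Filter.univ_mem' hc))
  refine ⟨x, hx, fun i => ?_⟩
  have h1 : Tendsto c (hyperfilter ℕ : Filter ℕ) (𝓝 x) := hle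
  have h2 : Tendsto (fun n => c n i) (hyperfilter ℕ : Filter ℕ) (𝓝 (x i)) :=
    (tendsto_pi_nhds.1 h1) i
  rw [nhds_discrete, tendsto_pure] at h2
  exact h2

/-- `t` is covered by a member of the family taking the value `j` on `t`. -/
def DMCov (ℱ : Set (ℕ → ℕ)) (j : ℕ) (t : Finset ℕ) : Prop := ∃ b ∈ ℱ, ∀ i ∈ t, b i = j

/-- One-step extension relation on covered sets. -/
def DMRel (ℱ : Set (ℕ → ℕ)) (j : ℕ) (t' t : Finset ℕ) : Prop :=
  DMCov ℱ j t' ∧ ∃ m, m ∉ t ∧ t' = insert m t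

lemma dm_gt (a : ℕ) : ∀ᶠ n in (Filter.hyperfilter ℕ : Filter ℕ), a < n := by
  have h : ∀ᶠ n in (Filter.atTop : Filter ℕ), a < n := Filter.eventually_gt_atTop a
  exact Nat.hyperfilter_le_atTop h

lemma dm_wf (ℱ : Set (ℕ → ℕ)) (hfin : ∀ f ∈ ℱ, (Function.support f).Finite)
    (hcomp : IsCompact ℱ) (j : ℕ) (hj : 1 ≤ j) : WellFounded (DMRel ℱ j) := by
  rw [wellFounded_iff_isEmpty_descending_chain]
  refine ⟨fun ⟨s, hs⟩ => ?_⟩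
  have hc : ∀ n, ∃ b ∈ ℱ, ∀ i ∈ s (n+1), b i = j := fun n => (hs n).1
  choose c hcF hcj using hc
  obtain ⟨x, hx, hlim⟩ := dm_lim ℱ hcomp c hcF
  have hmono : Monotone s := by
    refine monotone_nat_of_le_succ fun n => ?_
    obtain ⟨-, m, -, h⟩ := hs n
    rw [h]
    exact Finset.subset_insert _ _
  have hcard : ∀ n, n ≤ (s n).card := by
    intro n
    induction n with
    | zero => simp
    | succ n ih =>
      obtain ⟨-, m, hm, h⟩ := hs n
      rw [h, Finset.card_insert_of_notMem hm]
      omega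
  have hxj : ∀ n, ∀ i ∈ s n, x i = j := by
    intro n i hi
    obtain ⟨p, hp1, hp2⟩ := ((hlim i).and (dm_gt n)).exists
    rw [← hp1]
    exact hcj p i (hmono (by omega) hi)
  have hsub : ∀ n, s n ⊆ (hfin x hx).toFinset := by
    intro n i hi
    simp only [Set.Finite.mem_toFinset, Function.mem_support]
    rw [hxj n i hi]
    omega
  have h1 := Finset.card_le_card (hsub ((hfin x hx).toFinset.card + 1))
  have h2 := hcard ((hfin x hx).toFinset.card + 1)
  omega

/-- The property defining the choice function. -/
def DMP (ℱ : Set (ℕ → ℕ)) (j : ℕ) (t : Finset ℕ)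
    (g : ∀ t', DMRel ℱ j t' t → ℕ → ℕ) (x : ℕ → ℕ) : Prop :=
  x ∈ ℱ ∧ (∀ i ∈ t, x i = j) ∧
    ∀ i, ∀ᶠ m in (Filter.hyperfilter ℕ : Filter ℕ),
      ∀ h : DMRel ℱ j (insert m t) t, g (insert m t) h i = x i

lemma dm_g (ℱ : Set (ℕ → ℕ)) (hfin : ∀ f ∈ ℱ, (Function.support f).Finite)
    (hcomp : IsCompact ℱ) (j : ℕ) (hj : 1 ≤ j) :
    ∃ g : Finset ℕ → ℕ → ℕ, ∀ t, DMCov ℱ j t → DMP ℱ j t (fun t' _ => g t') (g t) := by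
  classical
  have wf := dm_wf ℱ hfin hcomp j hj
  let g : Finset ℕ → ℕ → ℕ := wf.fix (fun t ih => Classical.epsilon (DMP ℱ j t ih))
  have hg : ∀ t, g t = Classical.epsilon (DMP ℱ j t (fun t' _ => g t')) := fun t => wf.fix_eq _ t
  refine ⟨g, fun t => ?_⟩
  induction t using wf.induction with
  | _ t ih =>
  rintro ⟨b, hb, hbj⟩
  suffices h : ∃ x, DMP ℱ j t (fun t' _ => g t') x by
    have := Classical.epsilon_spec h
    rwa [← hg] at this
  let c : ℕ → ℕ → ℕ := fun m => if DMRel ℱ j (insert m t) t then g (insert m t) else b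
  have hc : ∀ m, c m ∈ ℱ ∧ ∀ i ∈ t, c m i = j := by
    intro m
    by_cases h : DMRel ℱ j (insert m t) t
    · simp only [c, if_pos h]
      have := ih _ h h.1
      exact ⟨this.1, fun i hi => this.2.1 i (Finset.mem_insert_of_mem hi)⟩
    · simp only [c, if_neg h]
      exact ⟨hb, hbj⟩
  obtain ⟨x, hx, hlim⟩ := dm_lim ℱ hcomp c (fun m => (hc m).1)
  refine ⟨x, hx, fun i hi => ?_, fun i => ?_⟩
  · obtain ⟨p, hp⟩ := (hlim i).exists
    rw [← hp]
    exact (hc p).2 i hi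
  · filter_upwards [hlim i] with m hm h
    simpa only [c, if_pos h] using hm


/-- Dual matching lemma: if `ℱ ⊆ {0,1,…,k}^ℕ` is a compact family (product topology,
`ℕ` discrete) of finitely supported sequences, then there is an infinite `M ⊆ ℕ` such
that the family of restrictions of `ℱ` to `M` is weakly hereditary: whenever `b ∈ ℱ`,
`1 ≤ j ≤ k`, and `a` satisfies `a ⊂_j b` on `M` (i.e. for every `i ∈ M` either `aᵢ = 0`
or `aᵢ = bᵢ = j`), the restriction of `a` to `M` coincides with that of some member of
`ℱ`. -/
theorem dual_matching_lemma (k : ℕ) (ℱ : Set (ℕ → ℕ))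
    (hval : ∀ f ∈ ℱ, ∀ i, f i ≤ k)
    (hfin : ∀ f ∈ ℱ, (Function.support f).Finite)
    (hcomp : IsCompact ℱ) :
    ∃ M : Set ℕ, M.Infinite ∧
      ∀ b ∈ ℱ, ∀ a : ℕ → ℕ, ∀ j : ℕ, 1 ≤ j → j ≤ k →
        (∀ i ∈ M, a i = 0 ∨ (a i = j ∧ b i = j)) →
        ∃ c ∈ ℱ, ∀ i ∈ M, c i = a i := by
  classical
  have hg : ∀ j, ∃ g : Finset ℕ → ℕ → ℕ, 1 ≤ j →
      ∀ t, DMCov ℱ j t → DMP ℱ j t (fun t' _ => g t') (g t) := by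
    intro j
    by_cases hj : 1 ≤ j
    · obtain ⟨g, hg⟩ := dm_g ℱ hfin hcomp j hj
      exact ⟨g, fun _ => hg⟩
    · exact ⟨fun _ _ => 0, fun h => absurd h hj⟩
  choose g hg using hg
  have hev : ∀ m : ℕ, ∀ᶠ x in (Filter.hyperfilter ℕ : Filter ℕ), m < x ∧
      ∀ j ∈ Finset.Icc 1 k, ∀ t ∈ (Finset.range (m+1)).powerset, DMCov ℱ j t →
        g j t x = 0 ∧ ∀ i ∈ Finset.range (m+1),
          (DMRel ℱ j (insert x t) t → g j (insert x t) i = g j t i) := by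
    intro m
    refine (dm_gt m).and ?_
    rw [Filter.eventually_all_finset]
    intro j hj
    rw [Filter.eventually_all_finset]
    intro t ht
    by_cases hcov : DMCov ℱ j t
    swap
    · exact Filter.Eventually.of_forall fun x h => absurd h hcov
    obtain ⟨h1, h2, h3⟩ := hg j (Finset.mem_Icc.1 hj).1 t hcov
    have hz : ∀ᶠ x in (Filter.hyperfilter ℕ : Filter ℕ), g j t x = 0 := by
      have hmem := (hfin _ h1).compl_mem_hyperfilter
      filter_upwards [hmem] with x hx
      simpa using hx
    have hl : ∀ᶠ x in (Filter.hyperfilter ℕ : Filter ℕ), ∀ i ∈ Finset.range (m+1),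
          (DMRel ℱ j (insert x t) t → g j (insert x t) i = g j t i) := by
      rw [Filter.eventually_all_finset]
      intro i _
      exact h3 i
    filter_upwards [hz, hl] with x hx1 hx2 _
    exact ⟨hx1, hx2⟩
  obtain ⟨f, -, hf⟩ := exists_seq_of_forall_finset_exists (fun _ : ℕ => True) _
    (fun s _ => by
      obtain ⟨y, hy⟩ := ((Filter.eventually_all_finset s).2 (fun m _ => hev m)).exists
      exact ⟨y, trivial, hy⟩)
  have hmono : StrictMono f := fun a b hab => (hf a b hab).1
  refine ⟨Set.range (fun n => f (n+1)), Set.infinite_range_of_injective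
    (fun a b hab => by have := hmono.injective hab; omega), ?_⟩
  intro b hb a j hj1 hjk hab
  have hj : j ∈ Finset.Icc 1 k := Finset.mem_Icc.2 ⟨hj1, hjk⟩
  have claim : ∀ t : Finset ℕ, (∀ i ∈ t, ∃ n, f (n+1) = i) → DMCov ℱ j t →
      ∀ n, f (n+1) ∉ t → g j t (f (n+1)) = 0 := by
    intro t
    have base : ∀ t : Finset ℕ, (∀ i ∈ t, ∃ n, f (n+1) = i) → ∀ n, (∀ i ∈ t, i < f (n+1)) →
        t ∈ (Finset.range (f n + 1)).powerset := by
      intro t ht n hlt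
      rw [Finset.mem_powerset]
      intro i hi
      obtain ⟨q, rfl⟩ := ht i hi
      have h1 := hmono.lt_iff_lt.1 (hlt _ hi)
      have h2 : f (q+1) ≤ f n := hmono.monotone (by omega)
      exact Finset.mem_range.2 (by omega)
    induction t using Finset.induction_on_max with
    | empty =>
      intro ht hcov n _
      exact ((hf n (n+1) (by omega)).2 j hj ∅ (base ∅ ht n (by simp)) hcov).1
    | insert x s hs ih =>
      intro ht hcov n hn
      have hts : ∀ i ∈ s, ∃ n, f (n+1) = i := fun i hi => ht i (Finset.mem_insert_of_mem hi)
      have hcs : DMCov ℱ j s := by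
        obtain ⟨b, hb, h⟩ := hcov
        exact ⟨b, hb, fun i hi => h i (Finset.mem_insert_of_mem hi)⟩
      obtain ⟨p, rfl⟩ := ht x (Finset.mem_insert_self _ _)
      have hne : f (n+1) ≠ f (p+1) := fun h => hn (by rw [h]; exact Finset.mem_insert_self _ _)
      have hns : f (n+1) ∉ s := fun h => hn (Finset.mem_insert_of_mem h)
      rcases lt_or_gt_of_ne hne with hlt | hgt
      · have h1 := hmono.lt_iff_lt.1 hlt
        have h2 : f (n+1) ≤ f p := hmono.monotone (by omega)
        have := ((hf p (p+1) (by omega)).2 j hj s (base s hts p hs) hcs).2 (f (n+1))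
          (Finset.mem_range.2 (by omega))
          ⟨hcov, f (p+1), fun h => lt_irrefl _ (hs _ h), rfl⟩
        rw [this]
        exact ih hts hcs n hns
      · refine ((hf n (n+1) (by omega)).2 j hj _ (base _ ht n ?_) hcov).1
        intro i hi
        rcases Finset.mem_insert.1 hi with rfl | hi
        · exact hgt
        · exact (hs i hi).trans hgt
  have hTfin : {i | (∃ n, f (n+1) = i) ∧ a i = j}.Finite := by
    refine (hfin b hb).subset ?_
    rintro i ⟨hi, hai⟩
    rcases hab i hi with h | h
    · omega
    · simp only [Function.mem_support]
      omega
  have hcov : DMCov ℱ j hTfin.toFinset := by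
    refine ⟨b, hb, fun i hi => ?_⟩
    obtain ⟨hi, hai⟩ := hTfin.mem_toFinset.1 hi
    rcases hab i hi with h | h
    · omega
    · exact h.2
  have hP := hg j hj1 _ hcov
  refine ⟨_, hP.1, ?_⟩
  rintro i ⟨n, rfl⟩
  by_cases hi : a (f (n+1)) = j
  · exact (hP.2.1 _ (hTfin.mem_toFinset.2 ⟨⟨n, rfl⟩, hi⟩)).trans hi.symm
  · have h0 : a (f (n+1)) = 0 := by
      rcases hab _ ⟨n, rfl⟩ with h | h
      · exact h
      · exact absurd h.1 hi
    refine Eq.trans (claim _ (fun i hi => (hTfin.mem_toFinset.1 hi).1) hcov n ?_) h0.symm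
    exact fun h => hi (hTfin.mem_toFinset.1 h).2
end
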